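/- Let H be an r-uniform hypergraph (r ≥ 3) whose longest Berge path has length ℓ with ℓ > r. Call a vertex set S good if |N_H(S)| ≤ |S|·C(ℓ, r−1)/r. Then at least one of the following holds: (1) H contains a good set of size 1 and a good set of size 2; (2) H contains a good set of size 2 and a good set of size 3; (3) the defining vertices of some Berge path of length ℓ form a connected component of H that either contains a Berge cycle of length ℓ+1, or contains a Berge cycle of length ℓ while the remaining defining vertex of the Berge path has degree 1 in H. -/

import Mathlib

/-- A Berge path of length `k` in a hypergraph with hyperedge set `E`. -/
def IsBergePath {V : Type*} (E : Finset (Finset V)) (k : ℕ)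
    (v : Fin (k + 1) → V) (h : Fin k → Finset V) : Prop :=
  Function.Injective v ∧ Function.Injective h ∧ (∀ i, h i ∈ E) ∧
    ∀ i : Fin k, v i.castSucc ∈ h i ∧ v i.succ ∈ h i

def HasBergePath {V : Type*} (E : Finset (Finset V)) (k : ℕ) : Prop :=
  ∃ v h, IsBergePath E k v h

/-- A Berge cycle of length `k`. -/
def IsBergeCycle {V : Type*} (E : Finset (Finset V)) (k : ℕ)
    (v : Fin k → V) (h : Fin k → Finset V) : Prop :=
  Function.Injective v ∧ Function.Injective h ∧ (∀ i, h i ∈ E) ∧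
    ∀ i : Fin k, v i ∈ h i ∧ v ⟨((i : ℕ) + 1) % k, Nat.mod_lt _ i.pos⟩ ∈ h i

/-- `N_H(S)`: the hyperedges containing at least one vertex of `S`. -/
def nbrEdges {V : Type*} [DecidableEq V] (E : Finset (Finset V)) (S : Finset V) :
    Finset (Finset V) :=
  E.filter (fun e => ∃ x ∈ S, x ∈ e)

/-- A set `S` is good (w.r.t. longest Berge path length `ℓ` in an `r`-graph) if
`|N_H(S)| ≤ |S|·C(ℓ, r−1)/r`. -/
def GoodSet {V : Type*} [DecidableEq V] (E : Finset (Finset V)) (ℓ r : ℕ)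
    (S : Finset V) : Prop :=
  r * (nbrEdges E S).card ≤ S.card * Nat.choose ℓ (r - 1)

/-- The degree of a vertex. -/
def degree {V : Type*} [DecidableEq V] (E : Finset (Finset V)) (x : V) : ℕ :=
  (E.filter (fun e => x ∈ e)).card

/-- Two vertices share a hyperedge of `E`. -/
def SharesEdge {V : Type*} (E : Finset (Finset V)) (x y : V) : Prop :=
  ∃ e ∈ E, x ∈ e ∧ y ∈ e

/-- `W` forms a connected component of the hypergraph: no hyperedge leaves `W`,
and any two vertices of `W` are connected by walking along hyperedges. -/
def IsConnComponent {V : Type*} (E : Finset (Finset V)) (W : Finset V) : Prop :=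
  (∀ e ∈ E, (∃ x ∈ e, x ∈ W) → ∀ y ∈ e, y ∈ W) ∧
    ∀ x ∈ W, ∀ y ∈ W, Relation.ReflTransGen (SharesEdge E) x y

namespace BergeGood

open Finset

theorem choose_le_choose_of_le_half {n k s : ℕ} (hks : k ≤ s) (hs : 2 * s ≤ n) :
    n.choose k ≤ n.choose s := by
  induction s, hks using Nat.le_induction with
  | base => exact le_rfl
  | succ s hks ih =>
    exact (ih (by omega)).trans (Nat.choose_le_succ_of_lt_half_left (by omega))

theorem choose_le_choose_of_central {n k s : ℕ} (hks : k ≤ s) (hs : s + k ≤ n) :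
    n.choose k ≤ n.choose s := by
  by_cases h : 2 * s ≤ n
  · exact choose_le_choose_of_le_half hks h
  · rw [← Nat.choose_symm (show s ≤ n by omega)]
    exact choose_le_choose_of_le_half (by omega) (by omega)

theorem choose_add_one_le_max (w : ℕ) {s : ℕ} (hs : 1 ≤ s) :
    w.choose s + 1 ≤ max 1 ((w + 1).choose s) := by
  rcases lt_or_ge w s with h | h
  · simp [Nat.choose_eq_zero_of_lt h]
  · obtain ⟨t, rfl⟩ : ∃ t, s = t + 1 := ⟨s - 1, by omega⟩
    have h1 := Nat.choose_pos (show t ≤ w by omega)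
    have h2 := Nat.choose_succ_succ' w t
    omega

theorem two_mul_choose_two (n : ℕ) : 2 * n.choose 2 = n * (n - 1) := by
  rw [Nat.choose_two_right, Nat.mul_div_cancel' (Nat.even_mul_pred_self n).two_dvd]

theorem two_pow_mul_choose_le {n c : ℕ} (h : 2 * c ≤ n) (s : ℕ) :
    2 ^ s * c.choose s ≤ n.choose s := by
  induction s generalizing n c with
  | zero => simp
  | succ s ih =>
    rcases c with _ | c
    · simp
    obtain ⟨n, rfl⟩ : ∃ m, n = m + 1 := ⟨n - 1, by omega⟩
    have h1 := Nat.add_one_mul_choose_eq c s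
    have h2 := Nat.add_one_mul_choose_eq n s
    have h3 := ih (n := n) (c := c) (by omega)
    have h4 : (s + 1) * (2 ^ (s + 1) * (c + 1).choose (s + 1)) ≤
        (s + 1) * (n + 1).choose (s + 1) := by
      calc _ = 2 * (c + 1) * (2 ^ s * c.choose s) := by
            rw [pow_succ]; linear_combination 2 * 2 ^ s * h1.symm
        _ ≤ (n + 1) * n.choose s := Nat.mul_le_mul h h3
        _ = _ := by rw [h2]; ring
    exact Nat.le_of_mul_le_mul_left h4 (by omega)

theorem add_two_le_two_pow {s : ℕ} (hs : 3 ≤ s) : 2 * (s + 1) ≤ 2 ^ s := by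
  induction s, hs using Nat.le_induction with
  | base => norm_num
  | succ s hs ih => rw [pow_succ]; omega

theorem mul_le_two_mul_choose {r l : ℕ} (hr : 3 ≤ r) (hl : r < l) :
    r * l ≤ 2 * l.choose (r - 1) := by
  have h := choose_le_choose_of_central (n := l) (k := 2) (s := r - 1) (by omega) (by omega)
  have h2 := two_mul_choose_two l
  have : r * l ≤ l * (l - 1) := by rw [mul_comm]; exact Nat.mul_le_mul_left _ (by omega)
  omega

theorem mul_degree_bound_le {r l c : ℕ} (hr : 3 ≤ r) (hl : r < l) (hc : 2 * c ≤ l) (hc1 : 1 ≤ c) :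
    r * (c - 1 + max 1 (c.choose (r - 1))) ≤ l.choose (r - 1) := by
  obtain ⟨s, rfl⟩ : ∃ s, r = s + 1 := ⟨r - 1, by omega⟩
  simp only [Nat.add_sub_cancel]
  obtain ⟨d, rfl⟩ : ∃ d, c = d + 1 := ⟨c - 1, by omega⟩
  simp only [Nat.add_sub_cancel]
  rcases lt_or_ge (d + 1) s with hcs | hcs
  · rw [Nat.choose_eq_zero_of_lt hcs]
    have := mul_le_two_mul_choose hr hl
    simp only [Nat.add_sub_cancel] at this
    simp only [zero_le, sup_of_le_left]
    nlinarith
  · rw [max_eq_right (Nat.choose_pos hcs)]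
    rcases eq_or_lt_of_le (show 2 ≤ s by omega) with rfl | hs
    · have h1 := Nat.choose_le_choose 2 hc
      have h2 := two_mul_choose_two (2 * (d + 1))
      have h3 := two_mul_choose_two (d + 1)
      have h4 : 2 * (d + 1) - 1 = 2 * d + 1 := by omega
      rw [h4] at h2
      simp only [Nat.add_sub_cancel] at h3
      have h5 : (d - 1 : ℤ) * (d - 2) ≥ 0 := by
        rcases lt_or_ge d 2 with h | h
        · obtain rfl : d = 1 := by omega
          norm_num
        · have : (2 : ℤ) ≤ d := by exact_mod_cast h
          nlinarith
      zify at *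
      nlinarith
    · rcases eq_or_lt_of_le hcs with rfl | hcs
      · have h1 := choose_le_choose_of_central (n := l) (k := 2) (s := d + 1) (by omega) (by omega)
        have h2 := two_mul_choose_two l
        rw [Nat.choose_self]
        obtain ⟨m, rfl⟩ : ∃ m, l = m + 1 := ⟨l - 1, by omega⟩
        simp only [Nat.add_sub_cancel] at h2
        nlinarith
      · have h1 := two_pow_mul_choose_le hc s
        have h2 := add_two_le_two_pow hs
        have h3 := choose_le_choose_of_central (n := d + 1) (k := 1) (s := s) (by omega) (by omega)
        rw [Nat.choose_one_right] at h3
        have h4 := Nat.mul_le_mul_right ((d + 1).choose s) h2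
        nlinarith

theorem mul_one_add_choose_le {r l m : ℕ} (hr : 3 ≤ r) (hl : r < l) (hm : 2 * m < l) :
    r * (1 + m.choose (r - 1)) ≤ l.choose (r - 1) := by
  rcases lt_or_ge m 2 with h | h
  · rw [Nat.choose_eq_zero_of_lt (show m < r - 1 by omega)]
    have := mul_le_two_mul_choose hr hl
    nlinarith
  · refine le_trans (Nat.mul_le_mul_left _ ?_)
      (mul_degree_bound_le hr hl (show 2 * m ≤ l by omega) (by omega))
    omega

theorem mul_add_two_mul_choose_le {r l m : ℕ} (hr : 3 ≤ r) (hl : r < l) (hm : 2 * m < l)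
    (hne : ¬ (r = 3 ∧ l = 5)) :
    r * (l + 2 * m.choose (r - 1)) ≤ 2 * l.choose (r - 1) := by
  have h0 := mul_le_two_mul_choose hr hl
  obtain ⟨s, rfl⟩ : ∃ s, r = s + 1 := ⟨r - 1, by omega⟩
  simp only [Nat.add_sub_cancel] at *
  rcases lt_or_ge m s with hms | hms
  · rw [Nat.choose_eq_zero_of_lt hms]
    simpa using h0
  rcases eq_or_lt_of_le (show 2 ≤ s by omega) with rfl | hs
  · have h2 := two_mul_choose_two l
    have h3 := two_mul_choose_two m
    obtain ⟨d, rfl⟩ : ∃ d, m = d + 1 := ⟨m - 1, by omega⟩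
    obtain ⟨q, rfl⟩ : ∃ q, l = q + 1 := ⟨l - 1, by omega⟩
    simp only [Nat.add_sub_cancel] at h2 h3
    rcases eq_or_lt_of_le (show 1 ≤ d by omega) with rfl | hd
    · nlinarith [show 5 ≤ q by omega]
    · nlinarith [show 2 * (d + 1) ≤ q by omega]
  · have h1 := two_pow_mul_choose_le (show 2 * m ≤ l by omega) s
    have h2 := Nat.mul_le_mul_right (m.choose s) (add_two_le_two_pow hs)
    have h3 := choose_le_choose_of_central (n := l) (k := 3) (s := s) (by omega) (by omega)
    obtain ⟨q, rfl⟩ : ∃ q, l = q + 1 := ⟨l - 1, by omega⟩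
    have h4 := Nat.add_one_mul_choose_eq q 2
    have h5 := two_mul_choose_two q
    obtain ⟨p, rfl⟩ : ∃ p, q = p + 1 := ⟨q - 1, by omega⟩
    simp only [Nat.add_sub_cancel] at h5
    have h6 : 6 * (s + 1) ≤ (p + 1) * p := by nlinarith [show 2 * s ≤ p + 1 by omega]
    have h7 : (p + 1 + 1) * (6 * (s + 1)) ≤ (p + 1 + 1) * ((p + 1) * p) :=
      Nat.mul_le_mul_left _ h6
    rw [← h5] at h7
    nlinarith

end BergeGood

namespace BergeGood

open Finset

variable {V : Type*} {E : Finset (Finset V)} {k : ℕ} {v : ℕ → V}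
  {h : ℕ → Finset V}

/-- A Berge path of length `k`, given by sequences of which only the first `k + 1` vertices and the
first `k` hyperedges matter. -/
structure SeqPath (E : Finset (Finset V)) (k : ℕ) (v : ℕ → V) (h : ℕ → Finset V) : Prop where
  vinj : ∀ i ≤ k, ∀ j ≤ k, v i = v j → i = j
  hinj : ∀ i < k, ∀ j < k, h i = h j → i = j
  mem : ∀ i < k, h i ∈ E
  left : ∀ i < k, v i ∈ h i
  right : ∀ i < k, v (i + 1) ∈ h i

def revV (k : ℕ) (v : ℕ → V) (j : ℕ) : V := v (k - j)

def revH (k : ℕ) (h : ℕ → Finset V) (j : ℕ) : Finset V := h (k - 1 - j)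

theorem SeqPath.rev (P : SeqPath E k v h) : SeqPath E k (revV k v) (revH k h) where
  vinj i hi j hj hij := by have := P.vinj _ (by omega) _ (by omega) hij; omega
  hinj i hi j hj hij := by have := P.hinj _ (by omega) _ (by omega) hij; omega
  mem i hi := P.mem _ (by omega)
  left i hi := by
    have := P.right (k - 1 - i) (by omega)
    rwa [show k - 1 - i + 1 = k - i by omega] at this
  right i hi := by
    have := P.left (k - 1 - i) (by omega)
    simp only [revV, revH]
    rwa [show k - 1 - i = k - (i + 1) by omega] at this ⊢

/-- Reverse the part of the path up to the `i`-th vertex. -/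
def rotV (i : ℕ) (v : ℕ → V) (j : ℕ) : V := if j ≤ i then v (i - j) else v j

/-- The hyperedges of the path with its first part reversed, the `i`-th one replaced by `e`. -/
def rotH (i : ℕ) (e : Finset V) (h : ℕ → Finset V) (j : ℕ) : Finset V :=
  if j < i then h (i - 1 - j) else if j = i then e else h j

theorem rotV_zero (i : ℕ) : rotV i v 0 = v i := by simp [rotV]

theorem rotV_last {i : ℕ} (hi : i < k) : rotV i v k = v k := by
  simp [rotV, Nat.not_le.2 hi]

def consSeq {α : Type*} (a : α) (f : ℕ → α) : ℕ → α
  | 0 => a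
  | n + 1 => f n

theorem SeqPath.tail (P : SeqPath E (k + 1) v h) :
    SeqPath E k (fun i => v (i + 1)) (fun i => h (i + 1)) where
  vinj i hi j hj hij := by have := P.vinj _ (by omega) _ (by omega) hij; omega
  hinj i hi j hj hij := by have := P.hinj _ (by omega) _ (by omega) hij; omega
  mem i hi := P.mem _ (by omega)
  left i hi := P.left _ (by omega)
  right i hi := P.right _ (by omega)

theorem SeqPath.isBergePath (P : SeqPath E k v h) :
    IsBergePath E k (fun i => v i) (fun i => h i) :=
  ⟨fun i j hij => Fin.ext (P.vinj i (by omega) j (by omega) hij),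
    fun i j hij => Fin.ext (P.hinj i i.2 j j.2 hij), fun i => P.mem i i.2,
    fun i => ⟨P.left i i.2, P.right i i.2⟩⟩

theorem exists_seqPath {v : Fin (k + 1) → V} {h : Fin k → Finset V} (P : IsBergePath E k v h) :
    ∃ v' h', SeqPath E k v' h' := by
  obtain ⟨hv, hh, hE, hvh⟩ := P
  refine ⟨fun i => if hi : i < k + 1 then v ⟨i, hi⟩ else v 0,
    fun i => if hi : i < k then h ⟨i, hi⟩ else ∅, ?_, ?_, ?_, ?_, ?_⟩
  · intro i hi j hj hij
    rw [dif_pos (by omega), dif_pos (by omega)] at hij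
    exact Fin.mk.inj (hv hij)
  · intro i hi j hj hij
    rw [dif_pos hi, dif_pos hj] at hij
    exact Fin.mk.inj (hh hij)
  · intro i hi
    rw [dif_pos hi]
    exact hE _
  · intro i hi
    rw [dif_pos hi, dif_pos (by omega)]
    exact (hvh ⟨i, hi⟩).1
  · intro i hi
    rw [dif_pos hi, dif_pos (by omega)]
    exact (hvh ⟨i, hi⟩).2

variable [DecidableEq V]

def verts (k : ℕ) (v : ℕ → V) : Finset V := (range (k + 1)).image v

def edges (k : ℕ) (h : ℕ → Finset V) : Finset (Finset V) := (range k).image h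

theorem mem_verts {x : V} : x ∈ verts k v ↔ ∃ i ≤ k, v i = x := by
  simp [verts]

theorem mem_edges {e : Finset V} : e ∈ edges k h ↔ ∃ i < k, h i = e := by
  simp [edges]

/-- A Berge cycle of length `k + 1` with vertex set `U`, as a path and a closing hyperedge. -/
def HasCycleOn (E : Finset (Finset V)) (k : ℕ) (U : Finset V) : Prop :=
  ∃ v h, SeqPath E k v h ∧ verts k v = U ∧ ∃ e ∈ E, e ∉ edges k h ∧ v 0 ∈ e ∧ v k ∈ e

theorem verts_rev : verts k (revV k v) = verts k v := by
  ext x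
  simp only [mem_verts, revV]
  constructor <;> rintro ⟨i, hi, rfl⟩
  · exact ⟨k - i, by omega, rfl⟩
  · exact ⟨k - i, by omega, by congr 1; omega⟩

theorem edges_rev : edges k (revH k h) = edges k h := by
  ext x
  simp only [mem_edges, revH]
  constructor <;> rintro ⟨i, hi, rfl⟩
  · exact ⟨k - 1 - i, by omega, rfl⟩
  · exact ⟨k - 1 - i, by omega, by congr 1; omega⟩

theorem mem_edges_rot {i : ℕ} (hi : i < k) {e f : Finset V} :
    f ∈ edges k (rotH i e h) ↔ f = e ∨ ∃ j < k, j ≠ i ∧ h j = f := by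
  simp only [mem_edges, rotH]
  constructor
  · rintro ⟨j, hj, rfl⟩
    split_ifs with h1 h2
    · exact Or.inr ⟨i - 1 - j, by omega, by omega, rfl⟩
    · exact Or.inl rfl
    · exact Or.inr ⟨j, hj, h2, rfl⟩
  · rintro (rfl | ⟨j, hj, hji, rfl⟩)
    · exact ⟨i, hi, by simp⟩
    · rcases lt_or_gt_of_ne hji with h1 | h1
      · refine ⟨i - 1 - j, by omega, ?_⟩
        rw [if_pos (by omega)]
        congr 1
        omega
      · exact ⟨j, hj, by rw [if_neg (by omega), if_neg hji]⟩

theorem edges_rot_self {i : ℕ} (hi : i < k) : edges k (rotH i (h i) h) = edges k h := by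
  ext f
  rw [mem_edges_rot hi, mem_edges]
  constructor
  · rintro (rfl | ⟨j, hj, -, rfl⟩)
    exacts [⟨i, hi, rfl⟩, ⟨j, hj, rfl⟩]
  · rintro ⟨j, hj, rfl⟩
    by_cases hji : j = i
    · exact Or.inl (by rw [hji])
    · exact Or.inr ⟨j, hj, hji, rfl⟩

theorem verts_rot {i : ℕ} (hi : i < k) : verts k (rotV i v) = verts k v := by
  ext x
  simp only [mem_verts, rotV]
  constructor
  · rintro ⟨j, hj, rfl⟩
    split_ifs with h1
    exacts [⟨i - j, by omega, rfl⟩, ⟨j, hj, rfl⟩]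
  · rintro ⟨j, hj, rfl⟩
    by_cases h1 : j ≤ i
    · refine ⟨i - j, by omega, ?_⟩
      rw [if_pos (by omega)]
      congr 1
      omega
    · exact ⟨j, hj, by rw [if_neg h1]⟩

theorem SeqPath.rot (P : SeqPath E k v h) {i : ℕ} (hi : i < k) {e : Finset V} (he : e ∈ E)
    (hnew : e = h i ∨ e ∉ edges k h) (h0 : v 0 ∈ e) (h1 : v (i + 1) ∈ e) :
    SeqPath E k (rotV i v) (rotH i e h) where
  vinj a ha b hb hab := by
    simp only [rotV] at hab
    split_ifs at hab
    all_goals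
      have := P.vinj _ (by omega) _ (by omega) hab
      omega
  hinj a ha b hb hab := by
    have key : ∀ j < k, j ≠ i → h j ≠ e := by
      rintro j hj hji rfl
      rcases hnew with hnew | hnew
      · exact hji (P.hinj _ hj _ hi hnew)
      · exact hnew (mem_edges.2 ⟨j, hj, rfl⟩)
    simp only [rotH] at hab
    split_ifs at hab
    all_goals first
      | omega
      | (have := P.hinj _ (by omega) _ (by omega) hab; omega)
      | (exact absurd hab (key _ (by omega) (by omega)))
      | (exact absurd hab.symm (key _ (by omega) (by omega)))
  mem a ha := by
    simp only [rotH]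
    split_ifs
    exacts [P.mem _ (by omega), he, P.mem _ ha]
  left a ha := by
    simp only [rotH, rotV]
    split_ifs with h2 h3 h4 h5
    any_goals omega
    · have := P.right (i - 1 - a) (by omega)
      rwa [show i - 1 - a + 1 = i - a by omega] at this
    · obtain rfl : a = i := by omega
      rwa [Nat.sub_self]
    · exact P.left a ha
  right a ha := by
    simp only [rotH, rotV]
    split_ifs with h2 h3 h4 h5
    any_goals omega
    · have := P.left (i - 1 - a) (by omega)
      rwa [show i - 1 - a = i - (a + 1) by omega] at this ⊢
    · obtain rfl : a = i := by omega
      exact h1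
    · exact P.right a ha

theorem SeqPath.not_closed (P : SeqPath E k v h) (hc : ¬ HasCycleOn E k (verts k v))
    {e : Finset V} (he : e ∈ E) (hF : e ∉ edges k h) (h0 : v 0 ∈ e) : v k ∉ e :=
  fun hk => hc ⟨v, h, P, rfl, e, he, hF, h0, hk⟩

theorem SeqPath.not_crossing (P : SeqPath E k v h) (hc : ¬ HasCycleOn E k (verts k v))
    {i : ℕ} (hi : i < k) {e e' : Finset V} (he : e ∈ E) (hnew : e = h i ∨ e ∉ edges k h)
    (h0 : v 0 ∈ e) (h1 : v (i + 1) ∈ e) (he' : e' ∈ E) (hF' : e' ∉ edges k h)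
    (hk : v k ∈ e') : v i ∉ e' := by
  intro hi'
  by_cases hee : e' = e
  · subst hee
    exact P.not_closed hc he hF' h0 hk
  · have R := P.rot hi he hnew h0 h1
    refine R.not_closed (by rwa [verts_rot hi]) he' ?_ (by rwa [rotV_zero]) (by rwa [rotV_last hi])
    rw [mem_edges_rot hi]
    rintro (hh | ⟨j, hj, -, rfl⟩)
    exacts [hee hh, hF' (mem_edges.2 ⟨j, hj, rfl⟩)]

theorem SeqPath.cons (P : SeqPath E k v h) {x : V} (hx : x ∉ verts k v) {e : Finset V}
    (he : e ∈ E) (hF : e ∉ edges k h) (hxe : x ∈ e) (h0 : v 0 ∈ e) :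
    SeqPath E (k + 1) (consSeq x v) (consSeq e h) where
  vinj i hi j hj hij := by
    rw [mem_verts] at hx
    push Not at hx
    rcases i with _ | i <;> rcases j with _ | j
    · rfl
    · exact absurd hij.symm (hx j (by omega))
    · exact absurd hij (hx i (by omega))
    · rw [P.vinj i (by omega) j (by omega) hij]
  hinj i hi j hj hij := by
    rw [mem_edges] at hF
    push Not at hF
    rcases i with _ | i <;> rcases j with _ | j
    · rfl
    · exact absurd hij.symm (hF j (by omega))
    · exact absurd hij (hF i (by omega))
    · rw [P.hinj i (by omega) j (by omega) hij]
  mem i hi := by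
    rcases i with _ | i
    exacts [he, P.mem i (by omega)]
  left i hi := by
    rcases i with _ | i
    exacts [hxe, P.left i (by omega)]
  right i hi := by
    rcases i with _ | i
    exacts [h0, P.right i (by omega)]

/-- A cycle opened at an arbitrary vertex, together with the hyperedges left on the path. -/
theorem SeqPath.open_cycle (P : SeqPath E k v h) {e : Finset V} (he : e ∈ E)
    (hF : e ∉ edges k h) (h0 : v 0 ∈ e) (hk : v k ∈ e) {m : ℕ} (hm : m ≤ k) :
    ∃ v' h', SeqPath E k v' h' ∧ verts k v' = verts k v ∧ v' 0 = v m ∧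
      ∀ f ∈ edges k h', (f = e ∧ m ≠ 0) ∨ ∃ i < k, i + 1 ≠ m ∧ h i = f := by
  have hF' : ∀ i < k, h i ≠ e := fun i hi hh => hF (mem_edges.2 ⟨i, hi, hh⟩)
  refine ⟨fun j => if j ≤ k - m then v (m + j) else v (m + j - k - 1),
    fun j => if j < k - m then h (m + j) else if j = k - m then e else h (m + j - k - 1),
    ⟨?_, ?_, ?_, ?_, ?_⟩, ?_, by simp, ?_⟩
  · intro i hi j hj hij
    split_ifs at hij
    all_goals
      have := P.vinj _ (by omega) _ (by omega) hij
      omega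
  · intro i hi j hj hij
    split_ifs at hij
    all_goals first
      | omega
      | (have := P.hinj _ (by omega) _ (by omega) hij; omega)
      | (exact absurd hij (hF' _ (by omega)))
      | (exact absurd hij.symm (hF' _ (by omega)))
  · intro i hi
    split_ifs
    exacts [P.mem _ (by omega), he, P.mem _ (by omega)]
  · intro i hi
    split_ifs with h1 h2 h3 h4
    any_goals omega
    · exact P.left _ (by omega)
    · rwa [h3, Nat.add_sub_cancel' hm]
    · exact P.left _ (by omega)
  · intro i hi
    split_ifs with h1 h2 h3 h4
    any_goals omega
    · exact P.right _ (by omega)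
    · rwa [show m + (i + 1) - k - 1 = 0 by omega]
    · have := P.right (m + i - k - 1) (by omega)
      rwa [show m + i - k - 1 + 1 = m + (i + 1) - k - 1 by omega] at this
  · ext x
    simp only [mem_verts]
    constructor
    · rintro ⟨j, hj, rfl⟩
      split_ifs
      exacts [⟨_, by omega, rfl⟩, ⟨_, by omega, rfl⟩]
    · rintro ⟨j, hj, rfl⟩
      by_cases hjm : m ≤ j
      · exact ⟨j - m, by omega, by rw [if_pos (by omega)]; congr 1; omega⟩
      · exact ⟨j + k + 1 - m, by omega, by rw [if_neg (by omega)]; congr 1; omega⟩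
  · intro f hf
    rw [mem_edges] at hf
    obtain ⟨j, hj, rfl⟩ := hf
    split_ifs with h1 h2
    · exact Or.inr ⟨m + j, by omega, by omega, rfl⟩
    · exact Or.inl ⟨rfl, by omega⟩
    · exact Or.inr ⟨m + j - k - 1, by omega, by omega, rfl⟩

/-- A hyperedge leaving the vertex set of a cycle extends it to a path of the same number of
hyperedges that starts outside. -/
theorem HasCycleOn.exists_path_of_leaving {U : Finset V} (hc : HasCycleOn E k U) {f : Finset V}
    (hf : f ∈ E) {u x : V} (hu : u ∈ f) (huU : u ∈ U) (hx : x ∈ f) (hxU : x ∉ U) :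
    ∃ v h, SeqPath E (k + 1) v h ∧ v 0 = x ∧ v (k + 1) ∈ U := by
  obtain ⟨v, h, P, rfl, e, he, hF, h0, hk⟩ := hc
  suffices H : ∃ m ≤ k, v m ∈ f ∧ (f = e → m = 0) ∧ ∀ i < k, h i = f → i + 1 = m by
    obtain ⟨m, hm, hmf, hfe, hfi⟩ := H
    obtain ⟨v', h', P', hV, hv0, hE⟩ := P.open_cycle he hF h0 hk hm
    refine ⟨consSeq x v', consSeq f h', P'.cons (by rwa [hV]) hf ?_ hx (by rwa [hv0]), rfl, ?_⟩
    · intro hmem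
      rcases hE f hmem with ⟨h1, h2⟩ | ⟨i, hi, him, hif⟩
      exacts [h2 (hfe h1), him (hfi i hi hif)]
    · rw [← hV]
      exact mem_verts.2 ⟨k, le_rfl, rfl⟩
  by_cases hfF : f ∈ edges k h
  · obtain ⟨i, hi, rfl⟩ := mem_edges.1 hfF
    refine ⟨i + 1, hi, P.right i hi, ?_, fun j hj hji => by rw [P.hinj j hj i hi hji]⟩
    rintro rfl
    exact absurd hfF hF
  · have hne : ∀ i < k, h i = f → False := fun i hi hh => hfF (mem_edges.2 ⟨i, hi, hh⟩)
    by_cases hfe : f = e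
    · exact ⟨0, by omega, hfe ▸ h0, fun _ => rfl, fun i hi hh => (hne i hi hh).elim⟩
    · obtain ⟨m, hm, rfl⟩ := mem_verts.1 huU
      exact ⟨m, hm, hu, fun hh => absurd hh hfe, fun i hi hh => (hne i hi hh).elim⟩

end BergeGood

namespace BergeGood

open Finset

variable {V : Type*} [DecidableEq V] {E F : Finset (Finset V)} {k r l : ℕ} {v : ℕ → V}
  {h : ℕ → Finset V} {x y : V}

/-- The hyperedges at `x` outside `F`. -/
def ext (E F : Finset (Finset V)) (x : V) : Finset (Finset V) :=
  E.filter (fun e => x ∈ e ∧ e ∉ F)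

/-- The vertices sharing with `x` a hyperedge outside `F`. -/
def nb (E F : Finset (Finset V)) (x : V) : Finset V := ((ext E F x).biUnion id).erase x

theorem mem_ext {e : Finset V} : e ∈ ext E F x ↔ e ∈ E ∧ x ∈ e ∧ e ∉ F := by simp [ext]

theorem mem_nb : y ∈ nb E F x ↔ y ≠ x ∧ ∃ e ∈ ext E F x, y ∈ e := by simp [nb]

theorem erase_subset_nb {e : Finset V} (he : e ∈ ext E F x) : e.erase x ⊆ nb E F x := by
  intro y hy
  rw [mem_erase] at hy
  exact mem_nb.2 ⟨hy.1, e, he, hy.2⟩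

theorem nb_subset_nb {G : Finset (Finset V)} (hs : ext E F x ⊆ ext E G x) :
    nb E F x ⊆ nb E G x := by
  intro y hy
  obtain ⟨h1, e, he, h2⟩ := mem_nb.1 hy
  exact mem_nb.2 ⟨h1, e, hs he, h2⟩

theorem card_le_choose_of_star {A : Finset (Finset V)} {W : Finset V} (x : V)
    (hA : ∀ e ∈ A, e.card = r ∧ x ∈ e ∧ e.erase x ⊆ W) : A.card ≤ W.card.choose (r - 1) := by
  rw [← card_powersetCard]
  refine card_le_card_of_injOn (fun e => e.erase x) ?_ ?_
  · intro e he
    obtain ⟨h1, h2, h3⟩ := hA e he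
    exact mem_coe.2 (mem_powersetCard.2 ⟨h3, by rw [card_erase_of_mem h2, h1]⟩)
  · intro e he f hf hef
    rw [← insert_erase (hA e he).2.1, ← insert_erase (hA f hf).2.1]
    exact congrArg _ hef

theorem card_ext_le (hunif : ∀ e ∈ E, e.card = r) :
    (ext E F x).card ≤ (nb E F x).card.choose (r - 1) :=
  card_le_choose_of_star x fun e he =>
    ⟨hunif e (mem_ext.1 he).1, (mem_ext.1 he).2.1, erase_subset_nb he⟩

theorem pred_le_card_nb (hunif : ∀ e ∈ E, e.card = r) (hne : (ext E F x).Nonempty) :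
    r - 1 ≤ (nb E F x).card := by
  obtain ⟨e, he⟩ := hne
  rw [← hunif e (mem_ext.1 he).1, ← card_erase_of_mem (mem_ext.1 he).2.1]
  exact card_le_card (erase_subset_nb he)

theorem card_nbrEdges_le_sum (S : Finset V) :
    (nbrEdges E S).card ≤ ∑ x ∈ S, degree E x := by
  refine le_trans (card_le_card ?_) card_biUnion_le
  intro e he
  simp only [nbrEdges, mem_filter, mem_biUnion] at he ⊢
  obtain ⟨h1, x, hx, hxe⟩ := he
  exact ⟨x, hx, h1, hxe⟩

theorem card_nbrEdges_le (F : Finset (Finset V)) (S : Finset V) :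
    (nbrEdges E S).card ≤
      (F.filter (fun e => ∃ x ∈ S, x ∈ e)).card + ∑ x ∈ S, (ext E F x).card := by
  refine le_trans (card_le_card (t := F.filter (fun e => ∃ x ∈ S, x ∈ e) ∪
    S.biUnion (ext E F)) ?_) ((card_union_le _ _).trans (Nat.add_le_add_left card_biUnion_le _))
  intro e he
  simp only [nbrEdges, mem_filter, mem_union, mem_biUnion, mem_ext] at he ⊢
  obtain ⟨h1, x, hx, hxe⟩ := he
  by_cases hF : e ∈ F
  · exact Or.inl ⟨hF, x, hx, hxe⟩
  · exact Or.inr ⟨x, hx, h1, hxe, hF⟩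

/-- The positions `i` such that the end of the path does not see the `i`-th vertex outside the
path. -/
def slots (E : Finset (Finset V)) (k : ℕ) (v : ℕ → V) (h : ℕ → Finset V) : Finset ℕ :=
  (range k).filter (fun i => v i ∉ nb E (edges k h) (v k))

/-- The positions of the hyperedges of the path containing its start. -/
def startIdx (k : ℕ) (v : ℕ → V) (h : ℕ → Finset V) : Finset ℕ :=
  (range k).filter (fun i => v 0 ∈ h i)

theorem mem_startIdx {i : ℕ} : i ∈ startIdx k v h ↔ i < k ∧ v 0 ∈ h i := by simp [startIdx]

theorem mem_slots {i : ℕ} :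
    i ∈ slots E k v h ↔ i < k ∧ v i ∉ nb E (edges k h) (v k) := by simp [slots]

theorem card_slots_add_le_of_subset {N : Finset V} (hN : N ⊆ nb E (edges k h) (v k))
    (hs : ∀ y ∈ N, ∃ i < k, v i = y) : (slots E k v h).card + N.card ≤ k := by
  have h1 : N ⊆ ((range k).filter (fun i => ¬ v i ∉ nb E (edges k h) (v k))).image v := by
    intro y hy
    obtain ⟨i, hi, rfl⟩ := hs y hy
    exact mem_image_of_mem _ (mem_filter.2 ⟨mem_range.2 hi, not_not.2 (hN hy)⟩)
  have h2 := (card_le_card h1).trans card_image_le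
  have h3 := card_filter_add_card_filter_not (s := range k)
    (fun i => v i ∉ nb E (edges k h) (v k))
  rw [card_range] at h3
  simp only [slots]
  omega

theorem SeqPath.card_slots_add_card_nb_le (hs : nb E (edges k h) (v k) ⊆ verts k v) :
    (slots E k v h).card + (nb E (edges k h) (v k)).card ≤ k := by
  refine card_slots_add_le_of_subset Subset.rfl fun y hy => ?_
  obtain ⟨i, hi, rfl⟩ := mem_verts.1 (hs hy)
  refine ⟨i, lt_of_le_of_ne hi ?_, rfl⟩
  rintro rfl
  exact (mem_nb.1 hy).1 rfl

theorem SeqPath.startIdx_subset_slots (P : SeqPath E k v h)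
    (hc : ¬ HasCycleOn E k (verts k v)) : startIdx k v h ⊆ slots E k v h := by
  intro i hi
  obtain ⟨hik, h0⟩ := mem_startIdx.1 hi
  refine mem_slots.2 ⟨hik, fun hn => ?_⟩
  obtain ⟨-, e, he, hie⟩ := mem_nb.1 hn
  obtain ⟨heE, hke, heF⟩ := mem_ext.1 he
  exact P.not_crossing hc hik (P.mem i hik) (Or.inl rfl) h0 (P.right i hik) heE heF hke hie

theorem SeqPath.erase_subset_image_slots (P : SeqPath E k v h)
    (hc : ¬ HasCycleOn E k (verts k v)) {e : Finset V} (he : e ∈ ext E (edges k h) (v 0))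
    (hs : e ⊆ verts k v) : e.erase (v 0) ⊆ (slots E k v h).image (fun i => v (i + 1)) := by
  intro y hy
  obtain ⟨hy0, hye⟩ := mem_erase.1 hy
  obtain ⟨heE, h0, heF⟩ := mem_ext.1 he
  obtain ⟨j, hj, rfl⟩ := mem_verts.1 (hs hye)
  obtain ⟨i, rfl⟩ : ∃ i, j = i + 1 := ⟨j - 1, by
    have : j ≠ 0 := by rintro rfl; exact hy0 rfl
    omega⟩
  refine mem_image.2 ⟨i, mem_slots.2 ⟨hj, fun hn => ?_⟩, rfl⟩
  obtain ⟨-, f, hf, hif⟩ := mem_nb.1 hn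
  obtain ⟨hfE, hkf, hfF⟩ := mem_ext.1 hf
  exact P.not_crossing hc hj heE (Or.inr heF) h0 hye hfE hfF hkf hif

theorem SeqPath.zero_mem_startIdx (P : SeqPath E k v h) (hk : 0 < k) : 0 ∈ startIdx k v h :=
  mem_startIdx.2 ⟨hk, P.left 0 hk⟩

theorem degree_le_card_startIdx_add :
    degree E (v 0) ≤ (startIdx k v h).card + (ext E (edges k h) (v 0)).card := by
  refine le_trans (card_le_card (t := (startIdx k v h).image h ∪ ext E (edges k h) (v 0)) ?_)
    ((card_union_le _ _).trans (Nat.add_le_add_right card_image_le _))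
  intro e he
  obtain ⟨heE, h0⟩ := mem_filter.1 he
  by_cases hF : e ∈ edges k h
  · obtain ⟨i, hi, rfl⟩ := mem_edges.1 hF
    exact mem_union_left _ (mem_image_of_mem _ (mem_startIdx.2 ⟨hi, h0⟩))
  · exact mem_union_right _ (mem_ext.2 ⟨heE, h0, hF⟩)

/-- If a hyperedge `e` outside the path meets the start, trading `h i` for `e` by a rotation does
not remove any hyperedge outside the path at the end of the path. -/
theorem SeqPath.ext_last_subset_rot (P : SeqPath E k v h) (hc : ¬ HasCycleOn E k (verts k v))
    {i : ℕ} (hi : i < k) {e : Finset V} (he : e ∈ ext E (edges k h) (v 0)) :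
    ext E (edges k h) (v k) ⊆ ext E (edges k (rotH i e h)) (v k) := by
  intro f hf
  obtain ⟨hfE, hkf, hfF⟩ := mem_ext.1 hf
  obtain ⟨heE, h0, heF⟩ := mem_ext.1 he
  refine mem_ext.2 ⟨hfE, hkf, fun hm => ?_⟩
  rcases (mem_edges_rot hi).1 hm with rfl | ⟨j, hj, -, rfl⟩
  · exact P.not_closed hc heE heF h0 hkf
  · exact hfF (mem_edges.2 ⟨j, hj, rfl⟩)

/-- `E` is `r`-uniform with no path longer than `l` and no cycle of length `l + 1`. -/
structure LongestBound (E : Finset (Finset V)) (r l : ℕ) : Prop where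
  three_le : 3 ≤ r
  lt : r < l
  unif : ∀ e ∈ E, e.card = r
  no_path : ∀ v h, ¬ SeqPath E (l + 1) v h
  no_cycle : ∀ U, ¬ HasCycleOn E l U

namespace LongestBound

theorem subset_verts (hE : LongestBound E r l) (P : SeqPath E l v h) {e : Finset V}
    (he : e ∈ ext E (edges l h) (v 0)) : e ⊆ verts l v := by
  intro x hx
  by_contra hxv
  obtain ⟨heE, h0, heF⟩ := mem_ext.1 he
  exact hE.no_path _ _ (P.cons hxv heE heF hx h0)

theorem nb_start_subset (hE : LongestBound E r l) (P : SeqPath E l v h) :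
    nb E (edges l h) (v 0) ⊆ verts l v := by
  intro x hx
  obtain ⟨-, e, he, hxe⟩ := mem_nb.1 hx
  exact hE.subset_verts P he hxe

theorem nb_end_subset (hE : LongestBound E r l) (P : SeqPath E l v h) :
    nb E (edges l h) (v l) ⊆ verts l v := by
  have := hE.nb_start_subset P.rev
  rwa [edges_rev, verts_rev] at this

theorem card_slots_add_le (hE : LongestBound E r l) (P : SeqPath E l v h) :
    (slots E l v h).card + (nb E (edges l h) (v l)).card ≤ l :=
  SeqPath.card_slots_add_card_nb_le (hE.nb_end_subset P)

theorem card_startIdx_add_le (hE : LongestBound E r l) (P : SeqPath E l v h) :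
    (startIdx l v h).card + (nb E (edges l h) (v l)).card ≤ l := by
  have h1 := card_le_card (P.startIdx_subset_slots (hE.no_cycle _))
  have h2 := hE.card_slots_add_le P
  omega

theorem degree_start_le (hE : LongestBound E r l) (P : SeqPath E l v h) :
    degree E (v 0) ≤
      (slots E l v h).card - 1 + max 1 ((slots E l v h).card.choose (r - 1)) := by
  have hr := hE.three_le
  have hl : 0 < l := by have := hE.lt; omega
  have hA := card_le_card (P.startIdx_subset_slots (hE.no_cycle _))
  have h0A := P.zero_mem_startIdx hl
  have hpos : 0 < (startIdx l v h).card := card_pos.2 ⟨0, h0A⟩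
  have hdeg := degree_le_card_startIdx_add (E := E) (k := l) (v := v) (h := h)
  set c := (slots E l v h).card
  by_cases h1 : ∃ e ∈ ext E (edges l h) (v 0), v 1 ∈ e
  · obtain ⟨e, he, h1e⟩ := h1
    obtain ⟨heE, h0e, heF⟩ := mem_ext.1 he
    have R := P.rot hl heE (Or.inr heF) h0e h1e
    have hstar : (insert (h 0) (ext E (edges l h) (v 0))).card ≤ c.choose (r - 1) := by
      refine le_trans (card_le_choose_of_star (r := r)
        (W := (slots E l v h).image (fun i => v (i + 1))) (v 0) ?_)
        (Nat.choose_le_choose _ card_image_le)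
      intro f hf
      rcases mem_insert.1 hf with rfl | hf
      · refine ⟨hE.unif _ (P.mem 0 hl), P.left 0 hl, ?_⟩
        have hm : h 0 ∈ ext E (edges l (rotH 0 e h)) (rotV 0 v 0) := by
          rw [rotV_zero]
          refine mem_ext.2 ⟨P.mem 0 hl, P.left 0 hl, fun hm => ?_⟩
          rcases (mem_edges_rot hl).1 hm with hh | ⟨j, hj, hj0, hh⟩
          · exact heF (hh ▸ mem_edges.2 ⟨0, hl, rfl⟩)
          · exact hj0 (P.hinj j hj 0 hl hh)
        have hs := R.erase_subset_image_slots (hE.no_cycle _) hm (hE.subset_verts R hm)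
        rw [rotV_zero] at hs
        intro y hy
        obtain ⟨i, hi, rfl⟩ := mem_image.1 (hs hy)
        obtain ⟨hil, hin⟩ := mem_slots.1 hi
        have hrv : ∀ j, rotV 0 v j = v j := by
          intro j
          simp only [rotV]
          split_ifs with hj
          · congr 1; omega
          · rfl
        rw [hrv, hrv] at hin
        refine mem_image.2 ⟨i, mem_slots.2 ⟨hil, fun hn => hin ?_⟩, (hrv _).symm⟩
        exact nb_subset_nb (P.ext_last_subset_rot (hE.no_cycle _) hl he) hn
      · exact ⟨hE.unif _ (mem_ext.1 hf).1, (mem_ext.1 hf).2.1,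
          P.erase_subset_image_slots (hE.no_cycle _) hf (hE.subset_verts P hf)⟩
    rw [card_insert_of_notMem fun hm => (mem_ext.1 hm).2.2 (mem_edges.2 ⟨0, hl, rfl⟩)] at hstar
    omega
  · have hstar : (ext E (edges l h) (v 0)).card ≤ (c - 1).choose (r - 1) := by
      have h0s := P.startIdx_subset_slots (hE.no_cycle _) h0A
      refine le_trans (card_le_choose_of_star (r := r)
        (W := ((slots E l v h).erase 0).image (fun i => v (i + 1))) (v 0) ?_)
        (Nat.choose_le_choose _ (card_image_le.trans (card_erase_of_mem h0s).le))
      intro f hf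
      refine ⟨hE.unif _ (mem_ext.1 hf).1, (mem_ext.1 hf).2.1, fun y hy => ?_⟩
      obtain ⟨i, hi, rfl⟩ := mem_image.1
        (P.erase_subset_image_slots (hE.no_cycle _) hf (hE.subset_verts P hf) hy)
      refine mem_image.2 ⟨i, mem_erase.2 ⟨?_, hi⟩, rfl⟩
      rintro rfl
      exact h1 ⟨f, hf, mem_of_mem_erase hy⟩
    have h2 := choose_add_one_le_max (c - 1) (show 1 ≤ r - 1 by omega)
    rw [show c - 1 + 1 = c by omega] at h2
    omega

/-- If the end of a longest path sees at least half of the vertices outside the path, then the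
start is good. -/
theorem mul_degree_start_le (hE : LongestBound E r l) (P : SeqPath E l v h)
    (hb : l ≤ 2 * (nb E (edges l h) (v l)).card) :
    r * degree E (v 0) ≤ l.choose (r - 1) := by
  have h1 := hE.card_slots_add_le P
  have hl : 0 < l := by have := hE.lt; omega
  have hpos : 0 < (slots E l v h).card :=
    card_pos.2 ⟨0, P.startIdx_subset_slots (hE.no_cycle _) (P.zero_mem_startIdx hl)⟩
  exact (Nat.mul_le_mul_left _ (hE.degree_start_le P)).trans
    (mul_degree_bound_le hE.three_le hE.lt (by omega) hpos)

end LongestBound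

end BergeGood

namespace BergeGood

open Finset

variable {V : Type*} [DecidableEq V] {E F : Finset (Finset V)} {k r l : ℕ} {v : ℕ → V}
  {h : ℕ → Finset V} {x y z : V}

def HasGood (E : Finset (Finset V)) (l r n : ℕ) : Prop :=
  ∃ S : Finset V, S.card = n ∧ GoodSet E l r S

theorem hasGood_one (hx : r * degree E x ≤ l.choose (r - 1)) : HasGood E l r 1 := by
  refine ⟨{x}, card_singleton x, ?_⟩
  have h1 := card_nbrEdges_le_sum (E := E) {x}
  rw [sum_singleton] at h1
  rw [GoodSet, card_singleton, one_mul]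
  exact (Nat.mul_le_mul_left _ h1).trans hx

theorem hasGood_two (hxy : x ≠ y)
    (hd : r * (degree E x + degree E y) ≤ 2 * l.choose (r - 1)) : HasGood E l r 2 := by
  refine ⟨{x, y}, card_pair hxy, ?_⟩
  have h1 := card_nbrEdges_le_sum (E := E) {x, y}
  rw [sum_pair hxy] at h1
  rw [GoodSet, card_pair hxy]
  exact (Nat.mul_le_mul_left _ h1).trans hd

theorem hasGood_of_ext {S : Finset V} {n m t : ℕ} (F : Finset (Finset V)) (hS : S.card = n)
    (hF : (F.filter (fun e => ∃ x ∈ S, x ∈ e)).card ≤ m)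
    (ht : ∑ x ∈ S, (ext E F x).card ≤ t)
    (hle : r * (m + t) ≤ n * l.choose (r - 1)) : HasGood E l r n := by
  refine ⟨S, hS, ?_⟩
  rw [GoodSet, hS]
  exact (Nat.mul_le_mul_left _ ((card_nbrEdges_le F S).trans (Nat.add_le_add hF ht))).trans hle

theorem card_edges_le : (edges k h).card ≤ k := card_image_le.trans (card_range k).le

theorem card_filter_edges_le (p : Finset V → Prop) [DecidablePred p] :
    ((edges k h).filter p).card ≤ k := (card_filter_le _ _).trans card_edges_le

namespace LongestBound

theorem card_ext_le_of_small (hE : LongestBound E r l) (hx : 2 * (nb E F x).card < l) :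
    (ext E F x).card ≤ ((l - 1) / 2).choose (r - 1) :=
  (card_ext_le hE.unif).trans (Nat.choose_le_choose _ (by omega))

theorem ends_ne (hE : LongestBound E r l) (P : SeqPath E l v h) : v 0 ≠ v l := by
  intro hh
  have := P.vinj 0 (by omega) l le_rfl hh
  have := hE.lt
  omega

theorem le_choose (hE : LongestBound E r l) : r ≤ l.choose (r - 1) := by
  have h1 := mul_le_two_mul_choose hE.three_le hE.lt
  have h2 : r * 2 ≤ r * l :=
    Nat.mul_le_mul_left r (by have := hE.three_le; have := hE.lt; omega)
  omega

theorem hasGood_two_of_small (hE : LongestBound E r l) (hne : ¬ (r = 3 ∧ l = 5))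
    (hxy : x ≠ y) (hx : 2 * (nb E (edges l h) x).card < l)
    (hy : 2 * (nb E (edges l h) y).card < l) : HasGood E l r 2 := by
  have hl := hE.lt
  refine hasGood_of_ext (edges l h) (card_pair hxy) (card_filter_edges_le _) ?_
    (mul_add_two_mul_choose_le hE.three_le hE.lt (show 2 * ((l - 1) / 2) < l by omega) hne)
  rw [sum_pair hxy]
  have h1 := hE.card_ext_le_of_small hx
  have h2 := hE.card_ext_le_of_small hy
  omega

theorem hasGood_three_of_small (hE : LongestBound E r l) (hxy : x ≠ y) (hxz : x ≠ z)
    (hyz : y ≠ z) (hx : 2 * (nb E (edges l h) x).card < l)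
    (hy : 2 * (nb E (edges l h) y).card < l) (hz : 2 * (nb E (edges l h) z).card < l) :
    HasGood E l r 3 := by
  have hl := hE.lt
  have hm : 2 * ((l - 1) / 2) < l := by omega
  refine hasGood_of_ext (S := {x, y, z}) (t := 3 * ((l - 1) / 2).choose (r - 1)) (edges l h)
    (card_eq_three.2 ⟨x, y, z, hxy, hxz, hyz, rfl⟩) (card_filter_edges_le _) ?_ ?_
  · rw [sum_insert (by simp [hxy, hxz]), sum_pair hyz]
    have h1 := hE.card_ext_le_of_small hx
    have h2 := hE.card_ext_le_of_small hy
    have h3 := hE.card_ext_le_of_small hz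
    omega
  · by_cases hne : r = 3 ∧ l = 5
    · obtain ⟨rfl, rfl⟩ := hne
      decide
    · have h1 := mul_add_two_mul_choose_le hE.three_le hE.lt hm hne
      have h2 := mul_one_add_choose_le hE.three_le hE.lt hm
      nlinarith

theorem card_ext_le_one (hE : LongestBound E 3 5) (hx : 2 * (nb E F x).card < 5) :
    (ext E F x).card ≤ 1 := hE.card_ext_le_of_small hx

theorem card_startIdx_le_three (hE : LongestBound E 3 5) (P : SeqPath E 5 v h)
    (hne : (ext E (edges 5 h) (v 5)).Nonempty) : (startIdx 5 v h).card ≤ 3 := by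
  have h1 := hE.card_startIdx_add_le P
  have h2 := pred_le_card_nb hE.unif hne
  omega

theorem hasGood_two_of_ext_empty (hE : LongestBound E 3 5) (hxy : x ≠ y)
    (hx : 2 * (nb E (edges 5 h) x).card < 5) (hy : ext E (edges 5 h) y = ∅) :
    HasGood E 5 3 2 := by
  refine hasGood_of_ext (t := 1) (edges 5 h) (card_pair hxy) (card_filter_edges_le _) ?_
    (by decide)
  rw [sum_pair hxy, hy]
  exact hE.card_ext_le_one hx

theorem rotated_ends (P : SeqPath E l v h) {i : ℕ} (hi : i ∈ startIdx l v h) :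
    ∃ v' h', SeqPath E l v' h' ∧ edges l h' = edges l h ∧ v' 0 = v i ∧ v' l = v l := by
  obtain ⟨hil, h0⟩ := mem_startIdx.1 hi
  exact ⟨_, _, P.rot hil (P.mem i hil) (Or.inl rfl) h0 (P.right i hil), edges_rot_self hil,
    rotV_zero i, rotV_last hil⟩

/-- A vertex of degree one together with a longest path ending elsewhere gives a good pair. -/
theorem hasGood_two_of_degree_one (hE : LongestBound E r l) (hz : degree E z = 1)
    (P : SeqPath E l v h) (h0 : v 0 ≠ z) (hl : v l ≠ z) : HasGood E l r 2 := by
  have hC := hE.le_choose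
  have single : ∀ x, x ≠ z → r * degree E x ≤ l.choose (r - 1) → HasGood E l r 2 := by
    intro x hx hd
    refine hasGood_two hx ?_
    rw [hz, mul_add, mul_one]
    omega
  rcases le_or_gt l (2 * (nb E (edges l h) (v l)).card) with hb | hb
  · exact single _ h0 (hE.mul_degree_start_le P hb)
  rcases le_or_gt l (2 * (nb E (edges l h) (v 0)).card) with hb' | hb'
  · have h1 := hE.mul_degree_start_le P.rev
    rw [edges_rev] at h1
    simp only [revV, Nat.sub_self, Nat.sub_zero] at h1
    exact single _ hl (h1 hb')
  by_cases hne : r = 3 ∧ l = 5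
  · obtain ⟨rfl, rfl⟩ := hne
    rcases (ext E (edges 5 h) (v 5)).eq_empty_or_nonempty with he | he
    · exact hE.hasGood_two_of_ext_empty (hE.ends_ne P) hb' he
    · have h1 := hE.card_startIdx_le_three P he
      have h2 := hE.card_ext_le_one hb'
      have h3 := degree_le_card_startIdx_add (E := E) (k := 5) (v := v) (h := h)
      refine hasGood_two h0 ?_
      have h4 : Nat.choose 5 (3 - 1) = 10 := by decide
      rw [hz, h4]
      omega
  · exact hE.hasGood_two_of_small hne (hE.ends_ne P) hb' hb

/-- Every end of a longest path sees fewer than half of the vertices outside the path. -/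
def SmallEnds (E : Finset (Finset V)) (l : ℕ) : Prop :=
  ∀ v h, SeqPath E l v h → 2 * (nb E (edges l h) (v 0)).card < l

theorem SmallEnds.last (hs : SmallEnds E l) (P : SeqPath E l v h) :
    2 * (nb E (edges l h) (v l)).card < l := by
  have h1 := hs _ _ P.rev
  rw [edges_rev] at h1
  simpa only [revV, Nat.sub_zero] using h1

theorem SmallEnds.of_mem_startIdx (hs : SmallEnds E l) (P : SeqPath E l v h) {i : ℕ}
    (hi : i ∈ startIdx l v h) : 2 * (nb E (edges l h) (v i)).card < l := by
  obtain ⟨v', h', P', hF, h0, -⟩ := rotated_ends P hi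
  have := hs v' h' P'
  rwa [hF, h0] at this

theorem ne_of_mem_startIdx (P : SeqPath E l v h) {i j : ℕ} (hi : i ∈ startIdx l v h)
    (hj : j ≤ l) (hij : i ≠ j) : v i ≠ v j := fun hh =>
  hij (P.vinj i (mem_startIdx.1 hi).1.le j hj hh)

theorem hasGood_three_of_two_le (hE : LongestBound E r l) (hs : SmallEnds E l)
    (P : SeqPath E l v h) (hA : 2 ≤ (startIdx l v h).card) : HasGood E l r 3 := by
  obtain ⟨i, hi, j, hj, hij⟩ := one_lt_card.1 hA
  exact hE.hasGood_three_of_small (ne_of_mem_startIdx P hi (mem_startIdx.1 hj).1.le hij)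
    (ne_of_mem_startIdx P hi le_rfl (mem_startIdx.1 hi).1.ne)
    (ne_of_mem_startIdx P hj le_rfl (mem_startIdx.1 hj).1.ne)
    (hs.of_mem_startIdx P hi) (hs.of_mem_startIdx P hj) (hs.last P)

theorem hasGood_two_of_three_le (hE : LongestBound E 3 5) (hs : SmallEnds E 5)
    (P : SeqPath E 5 v h) (hA : 3 ≤ (startIdx 5 v h).card) : HasGood E 5 3 2 := by
  by_contra hno
  have h0 := P.zero_mem_startIdx (by omega)
  have hA3 : (startIdx 5 v h).card ≤ 3 := by
    refine hE.card_startIdx_le_three P (nonempty_iff_ne_empty.2 fun he => hno ?_)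
    exact hE.hasGood_two_of_ext_empty (hE.ends_ne P) (hs _ _ P) he
  have key : ∀ x, v 0 ≠ x → 2 * (nb E (edges 5 h) x).card < 5 →
      ∀ f ∈ edges 5 h, v 0 ∉ f → x ∈ f := by
    intro x hx hxs f hf h0f
    by_contra hxf
    refine hno (hasGood_of_ext (m := 4) (t := 2) (edges 5 h) (card_pair hx) ?_ ?_ (by decide))
    · refine Nat.le_of_lt_succ (lt_of_lt_of_le (card_lt_card ?_) (card_edges_le (k := 5) (h := h)))
      exact filter_ssubset.2 ⟨f, hf, by simp [h0f, hxf]⟩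
    · rw [sum_pair hx]
      exact Nat.add_le_add (hE.card_ext_le_one (hs _ _ P)) (hE.card_ext_le_one hxs)
  obtain ⟨i, hi, j, hj, hij⟩ := one_lt_card.1
    (show 1 < ((startIdx 5 v h).erase 0).card by rw [card_erase_of_mem h0]; omega)
  rw [mem_erase] at hi hj
  obtain ⟨p, hp, q, hq, hpq⟩ := one_lt_card.1
    (show 1 < (range 5 \ startIdx 5 v h).card by
      have := le_card_sdiff (startIdx 5 v h) (range 5)
      rw [card_range] at this
      omega)
  rw [mem_sdiff, mem_range, mem_startIdx, not_and] at hp hq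
  have hT : ({v i, v j, v 5} : Finset V).card = 3 := card_eq_three.2
    ⟨_, _, _, ne_of_mem_startIdx P hi.2 (mem_startIdx.1 hj.2).1.le hij,
      ne_of_mem_startIdx P hi.2 le_rfl (mem_startIdx.1 hi.2).1.ne,
      ne_of_mem_startIdx P hj.2 le_rfl (mem_startIdx.1 hj.2).1.ne, rfl⟩
  have hall : ∀ m < 5, v 0 ∉ h m → {v i, v j, v 5} = h m := by
    intro m hm h0m
    have hmF : h m ∈ edges 5 h := mem_edges.2 ⟨m, hm, rfl⟩
    refine eq_of_subset_of_card_le ?_ (by rw [hT, hE.unif _ (P.mem m hm)])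
    intro y hy
    simp only [mem_insert, mem_singleton] at hy
    rcases hy with rfl | rfl | rfl
    · exact key _ (ne_of_mem_startIdx P h0 (mem_startIdx.1 hi.2).1.le hi.1.symm)
        (hs.of_mem_startIdx P hi.2) _ hmF h0m
    · exact key _ (ne_of_mem_startIdx P h0 (mem_startIdx.1 hj.2).1.le hj.1.symm)
        (hs.of_mem_startIdx P hj.2) _ hmF h0m
    · exact key _ (hE.ends_ne P) (hs.last P) _ hmF h0m
  exact hpq (P.hinj p hp.1 q hq.1
    ((hall p hp.1 (hp.2 hp.1)).symm.trans (hall q hq.1 (hq.2 hq.1))))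

theorem good_of_smallEnds (hE : LongestBound E r l) (hs : SmallEnds E l) (P : SeqPath E l v h) :
    (HasGood E l r 1 ∧ HasGood E l r 2) ∨ (HasGood E l r 2 ∧ HasGood E l r 3) := by
  have hdeg := degree_le_card_startIdx_add (E := E) (k := l) (v := v) (h := h)
  by_cases hne : r = 3 ∧ l = 5
  · obtain ⟨rfl, rfl⟩ := hne
    have h1 := hE.card_ext_le_one (hs _ _ P)
    by_cases hA : 3 ≤ (startIdx 5 v h).card
    · exact Or.inr ⟨hE.hasGood_two_of_three_le hs P hA,
        hE.hasGood_three_of_two_le hs P (by omega)⟩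
    by_cases hA' : 3 ≤ (startIdx 5 (revV 5 v) (revH 5 h)).card
    · exact Or.inr ⟨hE.hasGood_two_of_three_le hs P.rev hA',
        hE.hasGood_three_of_two_le hs P.rev (by omega)⟩
    have hdeg' := degree_le_card_startIdx_add (E := E) (k := 5) (v := revV 5 v) (h := revH 5 h)
    rw [edges_rev] at hdeg'
    simp only [revV, Nat.sub_zero] at hdeg'
    have h2 := hE.card_ext_le_one (hs.last P)
    have h3 : Nat.choose 5 (3 - 1) = 10 := by decide
    refine Or.inl ⟨hasGood_one (x := v 0) ?_, hasGood_two (hE.ends_ne P) ?_⟩ <;> rw [h3] <;> omega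
  · have h2 := hE.hasGood_two_of_small hne (hE.ends_ne P) (hs _ _ P) (hs.last P)
    by_cases hA : 2 ≤ (startIdx l v h).card
    · exact Or.inr ⟨h2, hE.hasGood_three_of_two_le hs P hA⟩
    · have hl := hE.lt
      refine Or.inl ⟨hasGood_one (x := v 0) ?_, h2⟩
      have h3 := hE.card_ext_le_of_small (hs _ _ P)
      exact (Nat.mul_le_mul_left _ (by omega)).trans
        (mul_one_add_choose_le hE.three_le hE.lt (show 2 * ((l - 1) / 2) < l by omega))

theorem good_of_large_end (hE : LongestBound E r l) (P : SeqPath E l v h)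
    (hb : l ≤ 2 * (nb E (edges l h) (v l)).card) (hd : degree E (v 0) ≠ 1) :
    HasGood E l r 1 ∧ HasGood E l r 2 := by
  have hl0 : 0 < l := by have := hE.lt; omega
  have h0 := hE.mul_degree_start_le P hb
  refine ⟨hasGood_one h0, ?_⟩
  suffices H : ∃ i, 0 < i ∧ i < l ∧ r * degree E (v i) ≤ l.choose (r - 1) by
    obtain ⟨i, hi0, hil, hi⟩ := H
    refine hasGood_two (x := v 0) (y := v i) (fun hh => ?_) (by rw [mul_add]; omega)
    have := P.vinj 0 hl0.le i hil.le hh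
    omega
  by_cases hA : 1 < (startIdx l v h).card
  · obtain ⟨i, hi, hi0⟩ := exists_mem_ne hA 0
    obtain ⟨v', h', P', hF, hv0, hvl⟩ := rotated_ends P hi
    refine ⟨i, by omega, (mem_startIdx.1 hi).1, ?_⟩
    rw [← hv0]
    exact hE.mul_degree_start_le P' (by rwa [hF, hvl])
  · have hdeg := degree_le_card_startIdx_add (E := E) (k := l) (v := v) (h := h)
    have hpos : 0 < degree E (v 0) :=
      card_pos.2 ⟨h 0, mem_filter.2 ⟨P.mem 0 hl0, P.left 0 hl0⟩⟩
    obtain ⟨e, he⟩ := card_pos.1 (show 0 < (ext E (edges l h) (v 0)).card by omega)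
    obtain ⟨heE, h0e, heF⟩ := mem_ext.1 he
    obtain ⟨y, hy⟩ : ((e.erase (v 0)).erase (v 1)).Nonempty := by
      rw [← card_pos]
      have h1 := pred_card_le_card_erase (s := e.erase (v 0)) (a := v 1)
      have h2 := pred_card_le_card_erase (s := e) (a := v 0)
      have h3 := hE.unif e heE
      have h4 := hE.three_le
      omega
    simp only [mem_erase] at hy
    obtain ⟨hy1, hy0, hye⟩ := hy
    obtain ⟨j, hj, rfl⟩ := mem_verts.1 (hE.subset_verts P he hye)
    obtain ⟨i, rfl⟩ : ∃ i, j = i + 2 := ⟨j - 2, by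
      have : j ≠ 0 := by rintro rfl; exact hy0 rfl
      have : j ≠ 1 := by rintro rfl; exact hy1 rfl
      omega⟩
    have hil : i + 1 < l := hj
    refine ⟨i + 1, by omega, hil, ?_⟩
    rw [← rotV_zero (v := v) (i + 1)]
    refine hE.mul_degree_start_le (P.rot hil heE (Or.inr heF) h0e hye) ?_
    rw [rotV_last hil]
    refine hb.trans (Nat.mul_le_mul_left _ (card_le_card (nb_subset_nb ?_)))
    exact P.ext_last_subset_rot (hE.no_cycle _) hil he

theorem verts_tail (P : SeqPath E (k + 1) v h) :
    verts k (fun i => v (i + 1)) = (verts (k + 1) v).erase (v 0) := by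
  ext x
  rw [mem_erase, mem_verts, mem_verts]
  constructor
  · rintro ⟨i, hi, rfl⟩
    refine ⟨fun hh => ?_, i + 1, by omega, rfl⟩
    have := P.vinj _ (by omega) _ (by omega) hh
    omega
  · rintro ⟨h0, j, hj, rfl⟩
    rcases j with _ | i
    exacts [absurd rfl h0, ⟨i, by omega, rfl⟩]

theorem cycle_of_degree_one (hE : LongestBound E r (k + 1)) (P : SeqPath E (k + 1) v h)
    (hb : k + 1 ≤ 2 * (nb E (edges (k + 1) h) (v (k + 1))).card) (hd : degree E (v 0) = 1)
    (hno : ¬ HasGood E (k + 1) r 2) :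
    HasCycleOn E k ((verts (k + 1) v).erase (v 0)) ∧
      ∀ f ∈ E, ∀ u ∈ f, u ∈ verts (k + 1) v → f ⊆ verts (k + 1) v := by
  have hr := hE.three_le
  have hlt := hE.lt
  have hdeg : ∀ e ∈ E, v 0 ∈ e → e = h 0 := by
    obtain ⟨g, hg⟩ := card_eq_one.1 hd
    have hmem : ∀ e ∈ E, v 0 ∈ e → e = g := fun e he h0 =>
      mem_singleton.1 (hg ▸ mem_filter.2 ⟨he, h0⟩)
    intro e he h0
    rw [hmem e he h0, hmem _ (P.mem 0 (by omega)) (P.left 0 (by omega))]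
  have hvne : ∀ i ≤ k, v (i + 1) ≠ v 0 := by
    intro i hi hh
    have := P.vinj _ (by omega) _ (by omega) hh
    omega
  have Q := P.tail
  have hV := verts_tail P
  set w : ℕ → V := fun i => v (i + 1) with hw
  set g : ℕ → Finset V := fun i => h (i + 1) with hg
  have hg0 : h 0 ∈ ext E (edges k g) (w 0) := by
    refine mem_ext.2 ⟨P.mem 0 (by omega), P.right 0 (by omega), fun hm => ?_⟩
    obtain ⟨i, hi, hh⟩ := mem_edges.1 hm
    have := P.hinj _ (by omega) _ (by omega) hh
    omega
  have hsub : ∀ e ∈ ext E (edges k g) (w 0), e ⊆ verts (k + 1) v := by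
    intro e he x hx
    by_contra hxv
    obtain ⟨heE, h1e, heF⟩ := mem_ext.1 he
    have hxw : x ∉ verts k w := fun hh => hxv (mem_of_mem_erase (hV ▸ hh))
    refine hno (hE.hasGood_two_of_degree_one hd (Q.cons hxw heE heF hx h1e) ?_ (hvne k le_rfl))
    rintro rfl
    exact hxv (mem_verts.2 ⟨0, by omega, rfl⟩)
  have hcyc : HasCycleOn E k (verts k w) := by
    by_contra hc
    have hext : (ext E (edges k g) (w 0)).card ≤ (slots E k w g).card.choose (r - 1) + 1 := by
      rw [← card_erase_add_one hg0]
      refine Nat.add_le_add_right (le_trans (card_le_choose_of_star (r := r)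
        (W := (slots E k w g).image (fun i => w (i + 1))) (w 0) ?_)
        (Nat.choose_le_choose _ card_image_le)) _
      intro e he
      obtain ⟨he0, he⟩ := mem_erase.1 he
      obtain ⟨heE, h1e, -⟩ := mem_ext.1 he
      refine ⟨hE.unif e heE, h1e, Q.erase_subset_image_slots hc he ?_⟩
      intro y hy
      rw [hV]
      refine mem_erase.2 ⟨?_, hsub e he hy⟩
      rintro rfl
      exact he0 (hdeg e heE hy)
    have hslots : (slots E k w g).card +
        (nb E (edges (k + 1) h) (v (k + 1))).card ≤ k := by
      refine card_slots_add_le_of_subset (nb_subset_nb fun e he => ?_) fun y hy => ?_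
      · obtain ⟨heE, hke, heF⟩ := mem_ext.1 he
        refine mem_ext.2 ⟨heE, hke, fun hm => heF ?_⟩
        obtain ⟨i, hi, rfl⟩ := mem_edges.1 hm
        exact mem_edges.2 ⟨i + 1, by omega, rfl⟩
      · obtain ⟨hyk, e, he, hye⟩ := mem_nb.1 hy
        obtain ⟨heE, -, heF⟩ := mem_ext.1 he
        obtain ⟨j, hj, rfl⟩ := mem_verts.1 (hE.nb_end_subset P hy)
        have hj0 : j ≠ 0 := by
          rintro rfl
          exact heF (hdeg e heE hye ▸ mem_edges.2 ⟨0, by omega, rfl⟩)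
        have hjk : j ≠ k + 1 := by
          rintro rfl
          exact hyk rfl
        refine ⟨j - 1, by omega, ?_⟩
        simp only [hw]
        congr 1
        omega
    have hA := card_le_card (Q.startIdx_subset_slots hc)
    have hd1 := degree_le_card_startIdx_add (E := E) (k := k) (v := w) (h := g)
    have hnum := mul_degree_bound_le (c := (slots E k w g).card + 1) hr hlt (by omega) (by omega)
    have hmax := choose_add_one_le_max (slots E k w g).card (show 1 ≤ r - 1 by omega)
    have hC := hE.le_choose
    have hd1' : r * degree E (w 0) ≤ (k + 1).choose (r - 1) :=
      (Nat.mul_le_mul_left _ (by omega)).trans hnum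
    refine hno (hasGood_two (hvne 0 (by omega)) ?_)
    rw [hd, mul_add, mul_one]
    exact (Nat.add_le_add hd1' hC).trans (two_mul _).ge
  refine ⟨hV ▸ hcyc, fun f hf u hu huV => ?_⟩
  by_cases hu0 : u = v 0
  · subst hu0
    rw [hdeg f hf hu]
    exact hsub _ hg0
  · intro x hx
    by_contra hxV
    obtain ⟨v', h', P', hx', hl'⟩ := hcyc.exists_path_of_leaving hf hu
      (hV ▸ mem_erase.2 ⟨hu0, huV⟩) hx (fun hh => hxV (mem_of_mem_erase (hV ▸ hh)))
    refine hno (hE.hasGood_two_of_degree_one hd P' ?_ ?_)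
    · rw [hx']
      rintro rfl
      exact hxV (mem_verts.2 ⟨0, by omega, rfl⟩)
    · rw [hV] at hl'
      exact (mem_erase.1 hl').1

end LongestBound

theorem HasCycleOn.exists_isBergeCycle {U : Finset V} (hc : HasCycleOn E k U) {n : ℕ}
    (hn : n = k + 1) : ∃ (c : Fin n → V) (g : Fin n → Finset V), IsBergeCycle E n c g ∧
      ∀ i, c i ∈ U := by
  subst hn
  obtain ⟨v, h, P, rfl, e, he, hF, h0, hk⟩ := hc
  have hF' : ∀ i < k, h i ≠ e := fun i hi hh => hF (mem_edges.2 ⟨i, hi, hh⟩)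
  refine ⟨fun i => v i, fun i => if (i : ℕ) < k then h i else e, ⟨?_, ?_, ?_, ?_⟩,
    fun i => mem_verts.2 ⟨i, by omega, rfl⟩⟩
  · exact fun i j hij => Fin.ext (P.vinj i (by omega) j (by omega) hij)
  · intro i j hij
    ext
    dsimp only at hij
    split_ifs at hij with hi hj hj
    · exact P.hinj i hi j hj hij
    · exact absurd hij (hF' i hi)
    · exact absurd hij.symm (hF' j hj)
    · omega
  · intro i
    dsimp only
    split_ifs with hi
    exacts [P.mem i hi, he]
  · intro i
    dsimp only
    split_ifs with hi
    · rw [Nat.mod_eq_of_lt (by omega)]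
      exact ⟨P.left i hi, P.right i hi⟩
    · obtain hik : (i : ℕ) = k := by omega
      rw [hik, Nat.mod_self]
      exact ⟨hk, h0⟩

theorem image_univ_eq_verts : image (fun i : Fin (l + 1) => v i) univ = verts l v := by
  ext x
  simp only [mem_image, mem_univ, true_and, mem_verts]
  exact ⟨fun ⟨i, hi⟩ => ⟨i, by omega, hi⟩, fun ⟨i, hi, hx⟩ => ⟨⟨i, by omega⟩, hx⟩⟩

theorem SeqPath.isConnComponent (P : SeqPath E l v h)
    (hcl : ∀ f ∈ E, ∀ u ∈ f, u ∈ verts l v → f ⊆ verts l v) :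
    IsConnComponent E (verts l v) := by
  refine ⟨fun e he ⟨x, hx, hxV⟩ y hy => hcl e he x hx hxV hy, ?_⟩
  have : Std.Symm (SharesEdge E) := ⟨fun _ _ ⟨e, he, h1, h2⟩ => ⟨e, he, h2, h1⟩⟩
  have key : ∀ i ≤ l, Relation.ReflTransGen (SharesEdge E) (v 0) (v i) := by
    intro i
    induction i with
    | zero => exact fun _ => .refl
    | succ i ih =>
      exact fun hi => (ih (by omega)).tail ⟨h i, P.mem i hi, P.left i hi, P.right i hi⟩
  intro x hx y hy
  obtain ⟨i, hi, rfl⟩ := mem_verts.1 hx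
  obtain ⟨j, hj, rfl⟩ := mem_verts.1 hy
  exact (Std.Symm.symm _ _ (key i hi)).trans (key j hj)

end BergeGood

/-- If the longest Berge path of an `r`-uniform hypergraph (`r ≥ 3`) has length
`ℓ > r`, then: there are good sets of sizes 1 and 2, or good sets of sizes 2 and 3,
or the defining vertices of some Berge path of length `ℓ` form a connected
component containing a Berge cycle of length `ℓ+1`, or one of length `ℓ` whose
remaining Berge-path vertex has degree 1. -/
theorem good_sets_or_component {V : Type*} [DecidableEq V] (r ℓ : ℕ) (hr : 3 ≤ r)
    (hℓ : r < ℓ)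
    (E : Finset (Finset V)) (hunif : ∀ e ∈ E, e.card = r)
    (hpath : HasBergePath E ℓ) (hlong : ∀ m, ℓ < m → ¬ HasBergePath E m) :
    ((∃ S : Finset V, S.card = 1 ∧ GoodSet E ℓ r S) ∧
     (∃ S : Finset V, S.card = 2 ∧ GoodSet E ℓ r S)) ∨
    ((∃ S : Finset V, S.card = 2 ∧ GoodSet E ℓ r S) ∧
     (∃ S : Finset V, S.card = 3 ∧ GoodSet E ℓ r S)) ∨
    (∃ (v : Fin (ℓ + 1) → V) (h : Fin ℓ → Finset V), IsBergePath E ℓ v h ∧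
      IsConnComponent E (Finset.image v Finset.univ) ∧
      ((∃ (c : Fin (ℓ + 1) → V) (g : Fin (ℓ + 1) → Finset V),
          IsBergeCycle E (ℓ + 1) c g ∧ ∀ i, c i ∈ Finset.image v Finset.univ) ∨
       (∃ (c : Fin ℓ → V) (g : Fin ℓ → Finset V),
          IsBergeCycle E ℓ c g ∧ (∀ i, c i ∈ Finset.image v Finset.univ) ∧
          ∃ w ∈ Finset.image v Finset.univ, (∀ i, c i ≠ w) ∧ degree E w = 1))) := by
  obtain ⟨v₀, h₀, hP⟩ := hpath
  obtain ⟨v, h, P⟩ := BergeGood.exists_seqPath hP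
  have hmax : ∀ v h, ¬ BergeGood.SeqPath E (ℓ + 1) v h := fun v h P =>
    hlong (ℓ + 1) (by omega) ⟨_, _, P.isBergePath⟩
  by_cases hcyc : ∃ U, BergeGood.HasCycleOn E ℓ U
  · obtain ⟨U, hU⟩ := hcyc
    obtain ⟨v, h, P, rfl, -⟩ := id hU
    refine Or.inr (Or.inr ⟨_, _, P.isBergePath, ?_⟩)
    rw [BergeGood.image_univ_eq_verts]
    refine ⟨P.isConnComponent fun f hf u hu huV x hx => ?_, Or.inl (hU.exists_isBergeCycle rfl)⟩
    by_contra hxV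
    obtain ⟨v', h', P', -⟩ := hU.exists_path_of_leaving hf hu huV hx hxV
    exact hmax v' h' P'
  have hE : BergeGood.LongestBound E r ℓ := ⟨hr, hℓ, hunif, hmax, not_exists.1 hcyc⟩
  by_cases hs : BergeGood.LongestBound.SmallEnds E ℓ
  · rcases hE.good_of_smallEnds hs P with hg | hg
    exacts [Or.inl hg, Or.inr (Or.inl hg)]
  obtain ⟨v, h, P, hb⟩ : ∃ v h, BergeGood.SeqPath E ℓ v h ∧
      ℓ ≤ 2 * (BergeGood.nb E (BergeGood.edges ℓ h) (v ℓ)).card := by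
    simp only [BergeGood.LongestBound.SmallEnds, not_forall, not_lt] at hs
    obtain ⟨v, h, P, hb⟩ := hs
    refine ⟨_, _, P.rev, ?_⟩
    rwa [BergeGood.edges_rev, BergeGood.revV, Nat.sub_self]
  by_cases hd : degree E (v 0) = 1
  swap
  · exact Or.inl (hE.good_of_large_end P hb hd)
  have h1 : BergeGood.HasGood E ℓ r 1 := BergeGood.hasGood_one (hE.mul_degree_start_le P hb)
  by_cases h2 : BergeGood.HasGood E ℓ r 2
  · exact Or.inl ⟨h1, h2⟩
  obtain ⟨k, rfl⟩ : ∃ k, ℓ = k + 1 := ⟨ℓ - 1, by omega⟩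
  obtain ⟨hc, hcl⟩ := hE.cycle_of_degree_one P hb hd h2
  obtain ⟨c, g, hcg, hcU⟩ := hc.exists_isBergeCycle rfl
  refine Or.inr (Or.inr ⟨_, _, P.isBergePath, ?_⟩)
  rw [BergeGood.image_univ_eq_verts]
  exact ⟨P.isConnComponent hcl, Or.inr ⟨c, g, hcg, fun i => Finset.mem_of_mem_erase (hcU i),
    v 0, BergeGood.mem_verts.2 ⟨0, by omega, rfl⟩,
    fun i => (Finset.mem_erase.1 (hcU i)).1, hd⟩⟩
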